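/- Let μ be a centered Gaussian probability measure on a real separable Banach space X, and let f, g : X → ℝ be measurable with e^f and e^{-g} μ-integrable. Define μ^{(f)}(dx) ∝ e^{f(x)} μ(dx) and μ^{(-g)}(dx) ∝ e^{-g(x)} μ(dx). Assume f + g is symmetric and quasi-concave and that μ^{(-g)} is again a centered Gaussian measure. Then for every symmetric convex set A ⊆ X, μ^{(f)}(A) ≥ μ^{(-g)}(A). -/

import Mathlib

open MeasureTheory ProbabilityTheory

/-- A centered Gaussian (probability) measure on a real separable Banach space. -/
def IsCenteredGaussian {X : Type*} [NormedAddCommGroup X] [NormedSpace ℝ X]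
    [MeasurableSpace X] [BorelSpace X] (μ : Measure X) : Prop :=
  IsProbabilityMeasure μ ∧ ∀ L : X →L[ℝ] ℝ, ∃ v : NNReal, μ.map L = gaussianReal 0 v

lemma integral_exp_neg_mul_sq_gaussianReal {a : ℝ} (ha : 0 < a) :
    ∫ x, Real.exp (-((a - 1) * x ^ 2 / 2)) ∂(gaussianReal 0 1) = (√a)⁻¹ := by
  rw [integral_gaussianReal_eq_integral_smul one_ne_zero]
  have h : ∀ x : ℝ, gaussianPDFReal 0 1 x • Real.exp (-((a - 1) * x ^ 2 / 2)) =
      (√(2 * Real.pi))⁻¹ * Real.exp (-(a / 2) * x ^ 2) := by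
    intro x
    simp only [gaussianPDFReal, NNReal.coe_one, mul_one, sub_zero, smul_eq_mul]
    rw [mul_assoc, ← Real.exp_add]
    congr 2
    ring
  simp_rw [h]
  rw [integral_const_mul, integral_gaussian, ← Real.sqrt_inv, ← Real.sqrt_inv,
    ← Real.sqrt_mul (by positivity)]
  congr 1
  have := Real.pi_pos
  field_simp

open Matrix in
lemma integral_exp_quadratic_stdGaussian {n : Type*} [Fintype n] [DecidableEq n]
    {A : Matrix n n ℝ} (hA : A.PosDef) :
    ∫ z, Real.exp (-((z.ofLp ⬝ᵥ ((A - 1) *ᵥ z.ofLp)) / 2)) ∂(stdGaussian (EuclideanSpace ℝ n)) =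
      (√A.det)⁻¹ := by
  set b := hA.isHermitian.eigenvectorBasis with hb
  have hmeas : Measurable fun x : n → ℝ ↦ ∑ i, x i • b i := by fun_prop
  rw [stdGaussian_eq_map_pi_orthonormalBasis b, integral_map hmeas.aemeasurable
    (Continuous.aestronglyMeasurable (by fun_prop))]
  have key : ∀ x : n → ℝ,
      (∑ i, x i • b i).ofLp ⬝ᵥ ((A - 1) *ᵥ (∑ i, x i • b i).ofLp) =
        ∑ i, (hA.isHermitian.eigenvalues i - 1) * x i ^ 2 := by
    intro x
    have h1 : (A - 1) *ᵥ (∑ i, x i • b i).ofLp =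
        (∑ i, ((hA.isHermitian.eigenvalues i - 1) * x i) • b i).ofLp := by
      simp only [WithLp.ofLp_sum, WithLp.ofLp_smul, mulVec_sum, mulVec_smul, sub_mulVec, one_mulVec]
      refine Finset.sum_congr rfl fun i _ ↦ ?_
      rw [hb, hA.isHermitian.mulVec_eigenvectorBasis i, smul_sub, smul_smul, sub_mul, sub_smul,
        one_mul, mul_comm]
    rw [h1]
    have h2 : ∀ u v : EuclideanSpace ℝ n, u.ofLp ⬝ᵥ v.ofLp = inner ℝ v u := by
      intro u v
      simp [EuclideanSpace.inner_eq_star_dotProduct]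
    rw [h2, b.orthonormal.inner_sum]
    exact Finset.sum_congr rfl fun i _ ↦ by simp; ring
  simp_rw [key, Finset.sum_div, ← Finset.sum_neg_distrib, Real.exp_sum]
  rw [integral_fintype_prod_eq_prod
    (f := fun i x ↦ Real.exp (-((hA.isHermitian.eigenvalues i - 1) * x ^ 2 / 2)))]
  simp_rw [integral_exp_neg_mul_sq_gaussianReal (hA.eigenvalues_pos _)]
  rw [hA.isHermitian.det_eq_prod_eigenvalues, Finset.prod_inv_distrib, ← Real.sqrt_prod]
  · rfl
  · exact fun i _ ↦ (hA.eigenvalues_pos i).le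

open Matrix in
lemma posDef_one_add_conj {m n : Type*} [Fintype m] [Fintype n] [DecidableEq m] [DecidableEq n]
    (R : Matrix m n ℝ) {l : m → ℝ} (hl : ∀ i, 0 ≤ l i) :
    (1 + Rᵀ * diagonal l * R).PosDef := by
  refine PosDef.one.add_posSemidef ?_
  have := (PosSemidef.diagonal hl).conjTranspose_mul_mul_same R
  simpa using this

open Matrix in
lemma det_one_add_diagonal_mul_gram {m n : Type*} [Fintype m] [Fintype n] [DecidableEq m]
    [DecidableEq n] (R : Matrix m n ℝ) (l : m → ℝ) :
    (1 + diagonal l * (R * Rᵀ)).det = (1 + Rᵀ * diagonal l * R).det := by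
  rw [← Matrix.mul_assoc, det_one_add_mul_comm, Matrix.mul_assoc]

open Matrix in
/-- Laplace transform of the squares of a centered Gaussian vector. -/
lemma integral_prod_exp_stdGaussian {m n : Type*} [Fintype m] [Fintype n] [DecidableEq m]
    [DecidableEq n] (R : Matrix m n ℝ) {l : m → ℝ} (hl : ∀ i, 0 ≤ l i) :
    ∫ z, ∏ i, Real.exp (-(l i * (R *ᵥ z.ofLp) i ^ 2 / 2)) ∂(stdGaussian (EuclideanSpace ℝ n)) =
      (√(1 + diagonal l * (R * Rᵀ)).det)⁻¹ := by
  rw [det_one_add_diagonal_mul_gram,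
    ← integral_exp_quadratic_stdGaussian (posDef_one_add_conj R hl)]
  congr 1
  ext z
  rw [← Real.exp_sum, Finset.sum_neg_distrib, ← Finset.sum_div]
  congr 3
  rw [add_sub_cancel_left, ← mulVec_mulVec, ← mulVec_mulVec, dotProduct_mulVec,
    vecMul_transpose]
  simp only [dotProduct, mulVec_diagonal]
  exact Finset.sum_congr rfl fun i _ ↦ by ring

/-- The coefficient of `∏ i ∈ J, l i` in `det (1 + diagonal l * C)`: the principal minor of `C`
on `J`. -/
noncomputable def Matrix.principalMinor {m : Type*} [Fintype m] [DecidableEq m]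
    (C : Matrix m m ℝ) (J : Finset m) : ℝ :=
  (Matrix.of (J.piecewise C (1 : Matrix m m ℝ))).det

open Matrix in
lemma det_one_add_diagonal_mul {m : Type*} [Fintype m] [DecidableEq m]
    (C : Matrix m m ℝ) (l : m → ℝ) :
    (1 + diagonal l * C).det = ∑ J : Finset m, C.principalMinor J * ∏ i ∈ J, l i := by
  have h : (1 + diagonal l * C : Matrix m m ℝ) =
      Matrix.of (fun i ↦ l i • C i) + 1 := by
    ext i j
    simp [diagonal_mul, add_comm]
  have h2 := (detRowAlternating (R := ℝ) (n := m)).toMultilinearMap.map_add_univ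
    (fun i ↦ l i • C i) (1 : Matrix m m ℝ)
  rw [h]
  refine h2.trans (Finset.sum_congr rfl fun J _ ↦ ?_)
  have h3 := (detRowAlternating (R := ℝ) (n := m)).toMultilinearMap.map_piecewise_smul
    l (J.piecewise C (1 : Matrix m m ℝ)) J
  have h4 : (J.piecewise (fun i ↦ l i • C i) (1 : Matrix m m ℝ) : m → m → ℝ) =
     J.piecewise (fun i ↦ l i • (J.piecewise C (1 : Matrix m m ℝ) : m → m → ℝ) i)
      (J.piecewise C (1 : Matrix m m ℝ)) := by
    ext i j
    by_cases hi : i ∈ J <;> simp [Finset.piecewise, hi]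
  rw [h4]
  refine h3.trans ?_
  rw [smul_eq_mul, mul_comm]
  rfl

open Matrix in
lemma principalMinor_eq {m : Type*} [Fintype m] [DecidableEq m]
    (C : Matrix m m ℝ) (J : Finset m) :
    C.principalMinor J = (diagonal (fun i ↦ if i ∈ J then (0:ℝ) else 1) +
      diagonal (fun i ↦ if i ∈ J then (1:ℝ) else 0) * C *
        diagonal (fun i ↦ if i ∈ J then (1:ℝ) else 0)).det := by
  set P : Matrix m m ℝ := diagonal (fun i ↦ if i ∈ J then (1:ℝ) else 0)
  have hP : P * P = P := by
    simp [P, diagonal_mul_diagonal]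
  have h1 : Matrix.of (J.piecewise C (1 : Matrix m m ℝ)) = 1 + P * (P * (C - 1)) := by
    rw [← Matrix.mul_assoc, hP]
    ext i j
    by_cases hi : i ∈ J <;> simp [Finset.piecewise, hi, P]
  have h2 : diagonal (fun i ↦ if i ∈ J then (0:ℝ) else 1) = 1 - P := by
    rw [← diagonal_one, diagonal_sub]
    congr 1
    ext i
    split_ifs <;> simp
  rw [principalMinor, h1, det_one_add_mul_comm, h2]
  congr 1
  rw [Matrix.mul_sub, Matrix.mul_one, Matrix.sub_mul, hP]
  abel

open Matrix in
lemma one_le_det_one_add {n : Type*} [Fintype n] [DecidableEq n] {M : Matrix n n ℝ}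
    (hM : M.PosSemidef) : 1 ≤ (1 + M).det := by
  have hH : (1 + M).IsHermitian := isHermitian_one.add hM.isHermitian
  rw [hH.det_eq_prod_eigenvalues]
  rw [← Finset.prod_const_one (s := Finset.univ (α := n))]
  refine Finset.prod_le_prod (fun _ _ ↦ zero_le_one) fun i _ ↦ ?_
  have hnorm : star (hH.eigenvectorBasis i).ofLp ⬝ᵥ (hH.eigenvectorBasis i).ofLp = 1 := by
    have := hH.eigenvectorBasis.orthonormal.1 i
    have h2 := real_inner_self_eq_norm_sq (hH.eigenvectorBasis i)
    rw [this, EuclideanSpace.inner_eq_star_dotProduct, dotProduct_comm] at h2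
    simpa using h2
  rw [hH.eigenvalues_eq]
  rw [add_mulVec, one_mulVec, dotProduct_add, hnorm]
  have := hM.dotProduct_mulVec_nonneg (hH.eigenvectorBasis i).ofLp
  simpa using this

open Matrix MatrixOrder in
lemma det_le_det_add {n : Type*} [Fintype n] [DecidableEq n] {P Q : Matrix n n ℝ}
    (hP : P.PosSemidef) (hQ : Q.PosSemidef) : P.det ≤ (P + Q).det := by
  by_cases h : P.det = 0
  · rw [h]
    exact (hP.add hQ).det_nonneg
  have hPd : P.PosDef := hP.posDef_iff_det_ne_zero.2 h
  obtain ⟨Y, rfl⟩ := CStarAlgebra.nonneg_iff_eq_star_mul_self.1 hQ.nonneg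
  rw [star_eq_conjTranspose] at hQ ⊢
  have hu : IsUnit P.det := isUnit_iff_ne_zero.2 h
  have h1 : P + Yᴴ * Y = P * (1 + (P⁻¹ * Yᴴ) * Y) := by
    rw [Matrix.mul_add, Matrix.mul_one, ← Matrix.mul_assoc, ← Matrix.mul_assoc,
      mul_nonsing_inv _ hu, Matrix.one_mul]
  rw [h1, det_mul, det_one_add_mul_comm, ← Matrix.mul_assoc]
  exact le_mul_of_one_le_right hPd.det_pos.le
    (one_le_det_one_add (hPd.inv.posSemidef.mul_mul_conjTranspose_same Y))

open Matrix in
lemma det_fromBlocks_smul_le_of_posDef {m n : Type*} [Fintype m] [DecidableEq m] [Fintype n]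
    [DecidableEq n] {A : Matrix m m ℝ} {B : Matrix m n ℝ} {D : Matrix n n ℝ}
    (hA : A.PosDef) (h : (fromBlocks A B Bᵀ D).PosSemidef) {s t : ℝ} (hs : 0 ≤ s) (hst : s ≤ t)
    (ht : t ≤ 1) :
    (fromBlocks A (t • B) (t • Bᵀ) D).det ≤ (fromBlocks A (s • B) (s • Bᵀ) D).det := by
  have : Invertible A := invertibleOfIsUnitDet A (isUnit_iff_ne_zero.2 hA.det_pos.ne')
  have h' : (D - Bᴴ * A⁻¹ * B).PosSemidef := (PosDef.fromBlocks₁₁ B D hA).1 (by simpa using h)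
  have hS : (Bᴴ * A⁻¹ * B).PosSemidef := hA.inv.posSemidef.conjTranspose_mul_mul_same B
  rw [det_fromBlocks₁₁, det_fromBlocks₁₁]
  refine mul_le_mul_of_nonneg_left ?_ hA.det_pos.le
  set S := Bᴴ * A⁻¹ * B with hSdef
  have hr : ∀ r : ℝ, D - r • Bᵀ * ⅟A * (r • B) = D - (r * r) • S := by
    intro r
    rw [hSdef, invOf_eq_nonsing_inv]
    simp [smul_smul]
  rw [hr, hr]
  have e : D - (s * s) • S = (D - S + (1 - t * t) • S) + (t * t - s * s) • S := by
    module
  have e2 : D - (t * t) • S = D - S + (1 - t * t) • S := by module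
  rw [e, e2]
  refine det_le_det_add (h'.add (hS.smul ?_)) (hS.smul ?_) <;> nlinarith

open Matrix in
lemma det_fromBlocks_smul_le {m n : Type*} [Fintype m] [DecidableEq m] [Fintype n]
    [DecidableEq n] {A : Matrix m m ℝ} {B : Matrix m n ℝ} {D : Matrix n n ℝ}
    (h : (fromBlocks A B Bᵀ D).PosSemidef) {s t : ℝ} (hs : 0 ≤ s) (hst : s ≤ t)
    (ht : t ≤ 1) :
    (fromBlocks A (t • B) (t • Bᵀ) D).det ≤ (fromBlocks A (s • B) (s • Bᵀ) D).det := by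
  have hA : A.PosSemidef := h.submatrix (Sum.inl : m → m ⊕ n)
  have hd : ∀ δ : ℝ, 0 < δ → (fromBlocks (A + δ • 1) (t • B) (t • Bᵀ) (D + δ • 1)).det ≤
      (fromBlocks (A + δ • 1) (s • B) (s • Bᵀ) (D + δ • 1)).det := by
    intro δ hδ
    refine det_fromBlocks_smul_le_of_posDef ?_ ?_ hs hst ht
    · exact PosDef.posSemidef_add hA (PosDef.one.smul hδ)
    · have e : fromBlocks (A + δ • 1) B Bᵀ (D + δ • 1) = fromBlocks A B Bᵀ D + δ • 1 := by
        rw [← fromBlocks_one, fromBlocks_smul, fromBlocks_add]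
        simp
      rw [e]
      exact h.add (PosSemidef.one.smul hδ.le)
  have hc : ∀ r : ℝ, Filter.Tendsto
      (fun δ : ℝ ↦ (fromBlocks (A + δ • 1) (r • B) (r • Bᵀ) (D + δ • 1)).det)
      (nhdsWithin 0 (Set.Ioi 0)) (nhds (fromBlocks A (r • B) (r • Bᵀ) D).det) := by
    intro r
    have : Continuous fun δ : ℝ ↦ (fromBlocks (A + δ • 1) (r • B) (r • Bᵀ) (D + δ • 1)).det := by
      fun_prop
    have h0 := this.tendsto 0
    simp only [zero_smul, add_zero] at h0
    exact h0.mono_left nhdsWithin_le_nhds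
  exact le_of_tendsto_of_tendsto (hc t) (hc s)
    (Filter.eventually_of_mem self_mem_nhdsWithin fun δ hδ ↦ hd δ hδ)

open Matrix in
/-- The interpolation of a block covariance matrix obtained by scaling its off-diagonal blocks. -/
def Matrix.interpBlocks {m n : Type*} (A : Matrix m m ℝ) (B : Matrix m n ℝ)
    (D : Matrix n n ℝ) (t : ℝ) : Matrix (m ⊕ n) (m ⊕ n) ℝ :=
  Matrix.fromBlocks A (t • B) (t • Bᵀ) D

open Matrix in
lemma posSemidef_interpBlocks {m n : Type*} [Fintype m] [DecidableEq m] [Fintype n]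
    [DecidableEq n] {A : Matrix m m ℝ} {B : Matrix m n ℝ} {D : Matrix n n ℝ}
    (h : (fromBlocks A B Bᵀ D).PosSemidef) {t : ℝ} (h0 : 0 ≤ t) (h1 : t ≤ 1) :
    (interpBlocks A B D t).PosSemidef := by
  set S : Matrix (m ⊕ n) (m ⊕ n) ℝ := fromBlocks 1 0 0 (-1)
  have e : interpBlocks A B D t = ((1 + t) / 2) • fromBlocks A B Bᵀ D +
      ((1 - t) / 2) • (Sᴴ * fromBlocks A B Bᵀ D * S) := by
    simp only [interpBlocks, S, fromBlocks_conjTranspose, fromBlocks_multiply, fromBlocks_smul,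
      fromBlocks_add]
    congr 1
    · simp; module
    · simp; module
    · simp; module
    · simp; module
  rw [e]
  exact (h.smul (by linarith)).add ((h.conjTranspose_mul_mul_same S).smul (by linarith))

open Matrix in
lemma antitoneOn_principalMinor_interpBlocks {m n : Type*} [Fintype m] [DecidableEq m] [Fintype n]
    [DecidableEq n] {A : Matrix m m ℝ} {B : Matrix m n ℝ} {D : Matrix n n ℝ}
    (h : (fromBlocks A B Bᵀ D).PosSemidef) (J : Finset (m ⊕ n)) :
    AntitoneOn (fun t ↦ (interpBlocks A B D t).principalMinor J) (Set.Icc 0 1) := by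
  intro s hs t ht hst
  set u : m ⊕ n → ℝ := fun i ↦ if i ∈ J then 0 else 1
  set v : m ⊕ n → ℝ := fun i ↦ if i ∈ J then 1 else 0
  have hdiag : ∀ w : m ⊕ n → ℝ, diagonal w =
      fromBlocks (diagonal (w ∘ Sum.inl)) 0 0 (diagonal (w ∘ Sum.inr)) := by
    intro w
    rw [fromBlocks_diagonal, Sum.elim_comp_inl_inr]
  set A' := diagonal (u ∘ Sum.inl) + diagonal (v ∘ Sum.inl) * A * diagonal (v ∘ Sum.inl)
  set B' := diagonal (v ∘ Sum.inl) * B * diagonal (v ∘ Sum.inr)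
  set D' := diagonal (u ∘ Sum.inr) + diagonal (v ∘ Sum.inr) * D * diagonal (v ∘ Sum.inr)
  have hB' : B'ᵀ = diagonal (v ∘ Sum.inr) * Bᵀ * diagonal (v ∘ Sum.inl) := by
    simp [B', Matrix.mul_assoc]
  have hr : ∀ r : ℝ, diagonal u + diagonal v * interpBlocks A B D r * diagonal v =
      fromBlocks A' (r • B') (r • B'ᵀ) D' := by
    intro r
    rw [hdiag u, hdiag v, interpBlocks, fromBlocks_multiply, fromBlocks_multiply, fromBlocks_add,
      hB']
    simp [A', B', D']
  have hpsd : (fromBlocks A' B' B'ᵀ D').PosSemidef := by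
    have h1 := hr 1
    simp only [interpBlocks, one_smul] at h1
    rw [← h1]
    refine PosSemidef.add (PosSemidef.diagonal fun i ↦ ?_) ?_
    · simp only [u]; positivity
    · have := h.conjTranspose_mul_mul_same (diagonal v)
      simpa using this
  simp only [principalMinor_eq]
  rw [hr, hr]
  exact det_fromBlocks_smul_le hpsd hs.1 hst ht.2

/-- The linear functional on products `∏ i, p i (t i)` of univariate polynomials determined by
its values `Φ k` on the monomials `∏ i, t i ^ k i`, truncated at degree `N`. -/
noncomputable def momentSum {m : Type*} [Fintype m] [DecidableEq m] (N : ℕ)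
    (p : m → Polynomial ℝ) (Φ : (m → ℕ) → ℝ) : ℝ :=
  ∑ k ∈ Fintype.piFinset fun _ : m ↦ Finset.range N, (∏ i, (p i).coeff (k i)) * Φ k

lemma prod_eval_eq_momentSum {m : Type*} [Fintype m] [DecidableEq m] {N : ℕ}
    {p : m → Polynomial ℝ} (hN : ∀ i, (p i).natDegree < N) (t : m → ℝ) :
    ∏ i, (p i).eval (t i) = momentSum N p fun k ↦ ∏ i, t i ^ k i := by
  simp_rw [Polynomial.eval_eq_sum_range' (hN _), momentSum, ← Finset.prod_mul_distrib]
  exact Finset.prod_univ_sum _ _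

lemma integral_prod_eval_eq_momentSum {m Ω : Type*} [Fintype m] [DecidableEq m]
    [MeasurableSpace Ω] {ρ : Measure Ω} [IsFiniteMeasure ρ] {N : ℕ}
    {p : m → Polynomial ℝ} (hN : ∀ i, (p i).natDegree < N) {T : Ω → m → ℝ}
    (hTm : ∀ i, Measurable fun ω ↦ T ω i) (hT : ∀ ω i, T ω i ∈ Set.Icc (0 : ℝ) 1) :
    ∫ ω, ∏ i, (p i).eval (T ω i) ∂ρ = momentSum N p fun k ↦ ∫ ω, ∏ i, T ω i ^ k i ∂ρ := by
  simp_rw [prod_eval_eq_momentSum hN, momentSum]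
  rw [integral_finsetSum]
  · simp_rw [integral_const_mul]
  · intro k _
    refine Integrable.const_mul (Integrable.of_bound (C := 1) ?_ ?_) _
    · exact (Finset.measurable_prod _ fun i _ ↦ (hTm i).pow_const _).aestronglyMeasurable
    · refine Filter.Eventually.of_forall fun ω ↦ ?_
      rw [Real.norm_of_nonneg (Finset.prod_nonneg fun i _ ↦ pow_nonneg (hT ω i).1 _)]
      exact Finset.prod_le_one (fun i _ ↦ pow_nonneg (hT ω i).1 _)
        fun i _ ↦ pow_le_one₀ (hT ω i).1 (hT ω i).2

open Matrix MatrixOrder in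
lemma det_one_add_diagonal_mul_pos {m : Type*} [Fintype m] [DecidableEq m] {M : Matrix m m ℝ}
    (hM : M.PosSemidef) {l : m → ℝ} (hl : ∀ i, 0 ≤ l i) : 0 < (1 + diagonal l * M).det := by
  obtain ⟨Y, rfl⟩ := CStarAlgebra.nonneg_iff_eq_star_mul_self.1 hM.nonneg
  have := det_one_add_diagonal_mul_gram Yᵀ l
  rw [transpose_transpose] at this
  rw [star_eq_conjTranspose, conjTranspose_eq_transpose_of_trivial, this]
  simpa using (posDef_one_add_conj Yᵀ hl).det_pos

open Matrix in
lemma prod_exp_pow {m n : Type*} [Fintype m] [Fintype n] (R : Matrix m n ℝ)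
    (k : m → ℕ) (z : n → ℝ) :
    ∏ i, Real.exp (-((R *ᵥ z) i ^ 2 / 2)) ^ k i =
      ∏ i, Real.exp (-((k i : ℝ) * (R *ᵥ z) i ^ 2 / 2)) := by
  refine Finset.prod_congr rfl fun i _ ↦ ?_
  rw [← Real.exp_nat_mul]
  ring_nf

lemma exp_neg_sq_mem_Icc (x : ℝ) : Real.exp (-(x ^ 2 / 2)) ∈ Set.Icc (0 : ℝ) 1 :=
  ⟨(Real.exp_pos _).le, Real.exp_le_one_iff.2 (by nlinarith [sq_nonneg x])⟩

open Matrix in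
lemma integral_prod_eval_stdGaussian {m n : Type*} [Fintype m] [Fintype n] [DecidableEq m]
    [DecidableEq n] (R : Matrix m n ℝ) {N : ℕ} {p : m → Polynomial ℝ}
    (hN : ∀ i, (p i).natDegree < N) :
    ∫ z, ∏ i, (p i).eval (Real.exp (-((R *ᵥ z.ofLp) i ^ 2 / 2)))
        ∂(stdGaussian (EuclideanSpace ℝ n)) =
      momentSum N p fun k ↦ (√(1 + diagonal (fun i ↦ (k i : ℝ)) * (R * Rᵀ)).det)⁻¹ := by
  have h := integral_prod_eval_eq_momentSum (ρ := stdGaussian (EuclideanSpace ℝ n)) hN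
    (T := fun z i ↦ Real.exp (-((R *ᵥ z.ofLp) i ^ 2 / 2)))
    (fun i ↦ Continuous.measurable (by fun_prop)) (fun z i ↦ exp_neg_sq_mem_Icc _)
  rw [h]
  congr 1
  ext k
  simp_rw [prod_exp_pow]
  exact integral_prod_exp_stdGaussian R fun i ↦ Nat.cast_nonneg _

open Matrix MatrixOrder in
lemma momentSum_cube_nonneg {m : Type*} [Fintype m] [DecidableEq m] {M : Matrix m m ℝ}
    (hM : M.PosSemidef) {N : ℕ} {p : m → Polynomial ℝ} (hN : ∀ i, (p i).natDegree < N)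
    (hp : ∀ i, ∀ t ∈ Set.Icc (0 : ℝ) 1, 0 ≤ (p i).eval t) :
    0 ≤ momentSum N p fun k ↦ ((√(1 + diagonal (fun i ↦ (k i : ℝ)) * M).det)⁻¹) ^ 3 := by
  obtain ⟨Y, rfl⟩ := CStarAlgebra.nonneg_iff_eq_star_mul_self.1 hM.nonneg
  set R := Yᵀ with hR
  have hY : star Y * Y = R * Rᵀ := by
    simp [R, star_eq_conjTranspose, conjTranspose_eq_transpose_of_trivial]
  rw [hY]
  set T : (Fin 3 → EuclideanSpace ℝ m) → m → ℝ := fun z i ↦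
    ∏ c, Real.exp (-((R *ᵥ (z c).ofLp) i ^ 2 / 2)) with hTdef
  have hT : ∀ z i, T z i ∈ Set.Icc (0 : ℝ) 1 := fun z i ↦
    ⟨Finset.prod_nonneg fun c _ ↦ (exp_neg_sq_mem_Icc _).1,
      Finset.prod_le_one (fun c _ ↦ (exp_neg_sq_mem_Icc _).1) fun c _ ↦ (exp_neg_sq_mem_Icc _).2⟩
  have h := integral_prod_eval_eq_momentSum
    (ρ := Measure.pi fun _ : Fin 3 ↦ stdGaussian (EuclideanSpace ℝ m)) hN (T := T)
    (fun i ↦ Continuous.measurable (by fun_prop)) hT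
  have hmom : ∀ k : m → ℕ, ∫ z, ∏ i, T z i ^ k i
      ∂(Measure.pi fun _ : Fin 3 ↦ stdGaussian (EuclideanSpace ℝ m)) =
      ((√(1 + diagonal (fun i ↦ (k i : ℝ)) * (R * Rᵀ)).det)⁻¹) ^ 3 := by
    intro k
    have e : ∀ z, ∏ i, T z i ^ k i =
        ∏ c, ∏ i, Real.exp (-((k i : ℝ) * (R *ᵥ (z c).ofLp) i ^ 2 / 2)) := by
      intro z
      simp_rw [← prod_exp_pow, hTdef, ← Finset.prod_pow]
      exact Finset.prod_comm
    simp_rw [e]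
    rw [integral_fintype_prod_eq_prod (μ := fun _ : Fin 3 ↦ stdGaussian (EuclideanSpace ℝ m))
      (f := fun (_ : Fin 3) (z : EuclideanSpace ℝ m) ↦
        ∏ i, Real.exp (-((k i : ℝ) * (R *ᵥ z.ofLp) i ^ 2 / 2)))]
    simp [integral_prod_exp_stdGaussian R (l := fun i ↦ (k i : ℝ)) fun i ↦ Nat.cast_nonneg _]
  simp_rw [hmom] at h
  rw [← h]
  exact integral_nonneg fun z ↦ Finset.prod_nonneg fun i _ ↦ hp i _ (hT z i)

open Matrix in
lemma differentiable_principalMinor_interpBlocks {m n : Type*} [Fintype m] [DecidableEq m]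
    [Fintype n] [DecidableEq n] (A : Matrix m m ℝ) (B : Matrix m n ℝ) (D : Matrix n n ℝ)
    (J : Finset (m ⊕ n)) :
    Differentiable ℝ fun t ↦ (interpBlocks A B D t).principalMinor J := by
  have hentry : ∀ i j, Differentiable ℝ fun t ↦ interpBlocks A B D t i j := by
    rintro (i | i) (j | j) <;> simp [interpBlocks]
  unfold principalMinor
  simp_rw [det_apply]
  refine Differentiable.fun_sum fun σ _ ↦ Differentiable.const_smul
    (Differentiable.fun_finsetProd fun i _ ↦ ?_) _
  by_cases hi : σ i ∈ J
  · simpa [Finset.piecewise, hi] using hentry (σ i) i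
  · simp [Finset.piecewise, hi]

open Matrix Polynomial in
/-- Royen's monotonicity: the expectation of a product of increasing polynomials in
`exp (-x i ^ 2 / 2)` increases along the interpolation of the covariance. -/
lemma momentSum_interpBlocks_le {m n : Type*} [Fintype m] [DecidableEq m]
    [Fintype n] [DecidableEq n] {A : Matrix m m ℝ} {B : Matrix m n ℝ} {D : Matrix n n ℝ}
    (h : (fromBlocks A B Bᵀ D).PosSemidef) {N : ℕ} {p : m ⊕ n → Polynomial ℝ}
    (hN : ∀ i, (p i).natDegree < N)
    (hp : ∀ i, ∀ t ∈ Set.Icc (0 : ℝ) 1, 0 ≤ (p i).eval t)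
    (hp' : ∀ i, ∀ t ∈ Set.Icc (0 : ℝ) 1, 0 ≤ (derivative (p i)).eval t) :
    (momentSum N p fun k ↦
        (√(1 + diagonal (fun i ↦ (k i : ℝ)) * interpBlocks A B D 0).det)⁻¹) ≤
      momentSum N p fun k ↦
        (√(1 + diagonal (fun i ↦ (k i : ℝ)) * interpBlocks A B D 1).det)⁻¹ := by
  set F : ℝ → ℝ := fun t ↦ momentSum N p fun k ↦
        (√(1 + diagonal (fun i ↦ (k i : ℝ)) * interpBlocks A B D t).det)⁻¹ with hF
  set c : Finset (m ⊕ n) → ℝ → ℝ := fun J t ↦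
    deriv (fun t ↦ (interpBlocks A B D t).principalMinor J) t with hc
  have hdet : ∀ (k : m ⊕ n → ℕ) (t : ℝ), HasDerivAt
      (fun t ↦ (1 + diagonal (fun i ↦ (k i : ℝ)) * interpBlocks A B D t).det)
      (∑ J, c J t * ∏ i ∈ J, (k i : ℝ)) t := by
    intro k t
    simp_rw [det_one_add_diagonal_mul]
    exact HasDerivAt.fun_sum fun J _ ↦
      ((differentiable_principalMinor_interpBlocks A B D J) t).hasDerivAt.mul_const _
  have hpos : ∀ (k : m ⊕ n → ℕ), ∀ t ∈ Set.Icc (0 : ℝ) 1,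
      0 < (1 + diagonal (fun i ↦ (k i : ℝ)) * interpBlocks A B D t).det := fun k t ht ↦
    det_one_add_diagonal_mul_pos (posSemidef_interpBlocks h ht.1 ht.2) fun i ↦ Nat.cast_nonneg _
  set q : Finset (m ⊕ n) → m ⊕ n → Polynomial ℝ := fun J i ↦
    if i ∈ J then X * derivative (p i) else p i with hq
  have hderiv : ∀ t ∈ Set.Icc (0 : ℝ) 1, HasDerivAt F
      (∑ J, (-(c J t) / 2) * momentSum N (q J) fun k ↦
        ((√(1 + diagonal (fun i ↦ (k i : ℝ)) * interpBlocks A B D t).det)⁻¹) ^ 3) t := by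
    intro t ht
    have h1 : HasDerivAt F (∑ k ∈ Fintype.piFinset fun _ : m ⊕ n ↦ Finset.range N,
        (∏ i, (p i).coeff (k i)) * (-(∑ J, c J t * ∏ i ∈ J, (k i : ℝ)) / 2 *
          ((√(1 + diagonal (fun i ↦ (k i : ℝ)) * interpBlocks A B D t).det)⁻¹) ^ 3)) t := by
      refine HasDerivAt.fun_sum fun k _ ↦ HasDerivAt.const_mul _ ?_
      have h2 : HasDerivAt
          (fun t ↦ (√(1 + diagonal (fun i ↦ (k i : ℝ)) * interpBlocks A B D t).det)⁻¹) _ t :=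
        ((hdet k t).sqrt (hpos k t ht).ne').inv (Real.sqrt_pos.2 (hpos k t ht)).ne'
      refine h2.congr_deriv ?_
      have := (Real.sqrt_pos.2 (hpos k t ht)).ne'
      field_simp
    convert h1 using 1
    simp_rw [momentSum, Finset.mul_sum]
    rw [Finset.sum_comm]
    refine Finset.sum_congr rfl fun k _ ↦ ?_
    have hcoeff : ∀ J, ∏ i, (q J i).coeff (k i) =
        (∏ i, (p i).coeff (k i)) * ∏ i ∈ J, (k i : ℝ) := by
      intro J
      have : ∏ i ∈ J, (k i : ℝ) = ∏ i, if i ∈ J then (k i : ℝ) else 1 := by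
        rw [Finset.prod_ite_mem, Finset.univ_inter]
      rw [this, ← Finset.prod_mul_distrib]
      refine Finset.prod_congr rfl fun i _ ↦ ?_
      simp only [hq]
      split_ifs
      · rcases hk : k i with _ | j
        · simp
        · rw [coeff_X_mul, coeff_derivative]
          push_cast
          ring
      · simp
    simp_rw [hcoeff]
    rw [← Finset.sum_neg_distrib, Finset.sum_div, Finset.sum_mul, Finset.mul_sum]
    exact Finset.sum_congr rfl fun J _ ↦ by ring
  have hmono : MonotoneOn F (Set.Icc 0 1) := by
    refine monotoneOn_of_deriv_nonneg (convex_Icc 0 1)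
      (fun t ht ↦ (hderiv t ht).continuousAt.continuousWithinAt)
      (fun t ht ↦ (hderiv t (interior_subset ht)).differentiableAt.differentiableWithinAt)
      fun t ht ↦ ?_
    rw [(hderiv t (interior_subset ht)).deriv]
    refine Finset.sum_nonneg fun J _ ↦ mul_nonneg ?_ ?_
    · have hcn : c J t ≤ 0 := by
        have h3 := (antitoneOn_principalMinor_interpBlocks h J).derivWithin_nonpos (x := t)
        rwa [derivWithin_of_mem_nhds (mem_interior_iff_mem_nhds.1 ht)] at h3
      linarith
    · have ht' := interior_subset ht
      refine momentSum_cube_nonneg (posSemidef_interpBlocks h ht'.1 ht'.2) ?_ ?_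
      · intro i
        simp only [hq]
        split_ifs
        · by_cases hd : (p i).natDegree = 0
          · rw [derivative_of_natDegree_zero hd]
            simpa [hd] using hN i
          · refine lt_of_le_of_lt ?_ (hN i)
            have := natDegree_derivative_lt hd
            refine natDegree_mul_le.trans ?_
            rw [natDegree_X]
            omega
        · exact hN i
      · intro i t ht
        simp only [hq]
        split_ifs
        · rw [eval_mul, eval_X]
          exact mul_nonneg ht.1 (hp' i t ht)
        · exact hp i t ht
  exact hmono (by simp) (by simp) zero_le_one

open Matrix Polynomial in
lemma integral_prod_eval_mul_le {m n o : Type*} [Fintype m] [DecidableEq m] [Fintype n]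
    [DecidableEq n] [Fintype o] [DecidableEq o] (R : Matrix m o ℝ) (S : Matrix n o ℝ)
    {p : m → Polynomial ℝ} {q : n → Polynomial ℝ}
    (hp : ∀ i, ∀ t ∈ Set.Icc (0 : ℝ) 1, 0 ≤ (p i).eval t)
    (hp' : ∀ i, ∀ t ∈ Set.Icc (0 : ℝ) 1, 0 ≤ (derivative (p i)).eval t)
    (hq : ∀ i, ∀ t ∈ Set.Icc (0 : ℝ) 1, 0 ≤ (q i).eval t)
    (hq' : ∀ i, ∀ t ∈ Set.Icc (0 : ℝ) 1, 0 ≤ (derivative (q i)).eval t) :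
    (∫ z, ∏ i, (p i).eval (Real.exp (-((R *ᵥ z.ofLp) i ^ 2 / 2)))
        ∂(stdGaussian (EuclideanSpace ℝ o))) *
      (∫ z, ∏ i, (q i).eval (Real.exp (-((S *ᵥ z.ofLp) i ^ 2 / 2)))
        ∂(stdGaussian (EuclideanSpace ℝ o))) ≤
      ∫ z, (∏ i, (p i).eval (Real.exp (-((R *ᵥ z.ofLp) i ^ 2 / 2)))) *
        ∏ i, (q i).eval (Real.exp (-((S *ᵥ z.ofLp) i ^ 2 / 2)))
        ∂(stdGaussian (EuclideanSpace ℝ o)) := by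
  set γ := stdGaussian (EuclideanSpace ℝ o) with hγ
  set P : m ⊕ n → Polynomial ℝ := Sum.elim p q with hP
  set N := (Finset.univ.sup fun i ↦ (P i).natDegree) + 1
  have hN : ∀ i, (P i).natDegree < N := fun i ↦ Nat.lt_succ_of_le
    (Finset.le_sup (f := fun i ↦ (P i).natDegree) (Finset.mem_univ i))
  have hgram : fromRows R S * (fromRows R S)ᵀ =
      fromBlocks (R * Rᵀ) (R * Sᵀ) (R * Sᵀ)ᵀ (S * Sᵀ) := by
    rw [transpose_fromRows, fromRows_mul_fromCols, transpose_mul, transpose_transpose]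
  have hpsd : (fromBlocks (R * Rᵀ) (R * Sᵀ) (R * Sᵀ)ᵀ (S * Sᵀ)).PosSemidef := by
    rw [← hgram]
    simpa using posSemidef_self_mul_conjTranspose (fromRows R S)
  have key := momentSum_interpBlocks_le hpsd hN (p := P)
    (by rintro (i | i); exacts [hp i, hq i]) (by rintro (i | i); exacts [hp' i, hq' i])
  have hright : (momentSum N P fun k ↦ (√(1 + diagonal (fun i ↦ (k i : ℝ)) *
      interpBlocks (R * Rᵀ) (R * Sᵀ) (S * Sᵀ) 1).det)⁻¹) =
      ∫ z, (∏ i, (p i).eval (Real.exp (-((R *ᵥ z.ofLp) i ^ 2 / 2)))) *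
        ∏ i, (q i).eval (Real.exp (-((S *ᵥ z.ofLp) i ^ 2 / 2))) ∂γ := by
    have := integral_prod_eval_stdGaussian (fromRows R S) hN
    rw [hgram] at this
    simp only [interpBlocks, one_smul]
    rw [← this]
    simp [Fintype.prod_sum_type, P, fromRows_mulVec, hγ]
  have hleft : (momentSum N P fun k ↦ (√(1 + diagonal (fun i ↦ (k i : ℝ)) *
      interpBlocks (R * Rᵀ) (R * Sᵀ) (S * Sᵀ) 0).det)⁻¹) =
      (∫ z, ∏ i, (p i).eval (Real.exp (-((R *ᵥ z.ofLp) i ^ 2 / 2))) ∂γ) *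
        ∫ z, ∏ i, (q i).eval (Real.exp (-((S *ᵥ z.ofLp) i ^ 2 / 2))) ∂γ := by
    rw [← integral_prod_mul]
    have := integral_prod_eval_eq_momentSum (ρ := γ.prod γ) hN (p := P)
      (T := fun z ↦ Sum.elim (fun i ↦ Real.exp (-((R *ᵥ z.1.ofLp) i ^ 2 / 2)))
        fun i ↦ Real.exp (-((S *ᵥ z.2.ofLp) i ^ 2 / 2)))
      (by rintro (i | i) <;> exact Continuous.measurable (by dsimp; fun_prop))
      (by rintro z (i | i) <;> exact exp_neg_sq_mem_Icc _)
    simp only [Fintype.prod_sum_type, P, Sum.elim_inl, Sum.elim_inr] at this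
    rw [this]
    congr 1
    ext k
    simp_rw [prod_exp_pow]
    rw [integral_prod_mul
      (fun z : EuclideanSpace ℝ o ↦
        ∏ i, Real.exp (-((k (Sum.inl i) : ℝ) * (R *ᵥ z.ofLp) i ^ 2 / 2)))
      (fun z : EuclideanSpace ℝ o ↦
        ∏ i, Real.exp (-((k (Sum.inr i) : ℝ) * (S *ᵥ z.ofLp) i ^ 2 / 2))),
      integral_prod_exp_stdGaussian R (l := fun i ↦ (k (Sum.inl i) : ℝ)) fun i ↦ Nat.cast_nonneg _,
      integral_prod_exp_stdGaussian S (l := fun i ↦ (k (Sum.inr i) : ℝ)) fun i ↦ Nat.cast_nonneg _,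
      ← mul_inv, ← Real.sqrt_mul]
    · congr 3
      have hd : (diagonal fun i ↦ (k i : ℝ)) = fromBlocks (diagonal fun i ↦ (k (Sum.inl i) : ℝ)) 0 0
          (diagonal fun i ↦ (k (Sum.inr i) : ℝ)) := by
        rw [fromBlocks_diagonal]
        congr 1
        ext (i | i) <;> rfl
      rw [hd, interpBlocks, zero_smul, zero_smul, fromBlocks_multiply, ← fromBlocks_one,
        fromBlocks_add]
      simp [det_fromBlocks_zero₂₁]
    · refine (det_one_add_diagonal_mul_pos ?_ fun i ↦ Nat.cast_nonneg _).le
      simpa using posSemidef_self_mul_conjTranspose R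
  rw [hleft, hright] at key
  exact key

/-- Increasing polynomials on `[0, 1]` approximating the indicator of `[exp (-c ^ 2 / 2), 1]`. -/
noncomputable def slabPoly (c : ℝ) (k : ℕ) : Polynomial ℝ :=
  1 - (1 - Polynomial.X ^ k) ^ ⌈k * Real.exp (k * (c ^ 2 / 2))⌉₊

lemma eval_slabPoly (c : ℝ) (k : ℕ) (t : ℝ) : (slabPoly c k).eval t =
    1 - (1 - t ^ k) ^ ⌈k * Real.exp (k * (c ^ 2 / 2))⌉₊ := by
  simp [slabPoly]

lemma eval_slabPoly_mem_Icc (c : ℝ) (k : ℕ) {t : ℝ} (ht : t ∈ Set.Icc (0 : ℝ) 1) :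
    (slabPoly c k).eval t ∈ Set.Icc (0 : ℝ) 1 := by
  have h1 : t ^ k ≤ 1 := pow_le_one₀ ht.1 ht.2
  have h0 : 0 ≤ t ^ k := pow_nonneg ht.1 k
  rw [eval_slabPoly]
  have h2 := pow_le_one₀ (n := ⌈k * Real.exp (k * (c ^ 2 / 2))⌉₊) (sub_nonneg.2 h1) (by linarith)
  have h3 := pow_nonneg (sub_nonneg.2 h1) ⌈k * Real.exp (k * (c ^ 2 / 2))⌉₊
  constructor <;> linarith

lemma eval_derivative_slabPoly_nonneg (c : ℝ) (k : ℕ) {t : ℝ} (ht : t ∈ Set.Icc (0 : ℝ) 1) :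
    0 ≤ (Polynomial.derivative (slabPoly c k)).eval t := by
  have h1 : 0 ≤ 1 - t ^ k := sub_nonneg.2 (pow_le_one₀ ht.1 ht.2)
  have h0 : 0 ≤ t := ht.1
  simp only [slabPoly, Polynomial.derivative_sub, Polynomial.derivative_one,
    Polynomial.derivative_pow, Polynomial.derivative_X, Polynomial.eval_sub,
    Polynomial.eval_mul, Polynomial.eval_pow, Polynomial.eval_one, Polynomial.eval_X,
    zero_sub, mul_one, mul_neg, neg_neg, Polynomial.eval_C]
  positivity

open Filter Topology in
lemma tendsto_eval_slabPoly {c : ℝ} (hc : 0 ≤ c) (x : ℝ) :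
    Tendsto (fun k ↦ (slabPoly c k).eval (Real.exp (-(x ^ 2 / 2)))) atTop
      (𝓝 (if |x| ≤ c then 1 else 0)) := by
  simp_rw [eval_slabPoly]
  set t := Real.exp (-(x ^ 2 / 2)) with ht
  have hmem : t ∈ Set.Icc (0 : ℝ) 1 := exp_neg_sq_mem_Icc x
  set r := t * Real.exp (c ^ 2 / 2) with hr
  have hrk : ∀ k : ℕ, k * Real.exp (k * (c ^ 2 / 2)) * t ^ k = k * r ^ k := fun k ↦ by
    rw [hr, mul_pow, ← Real.exp_nat_mul (c ^ 2 / 2)]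
    ring
  have hbase : ∀ k : ℕ, 0 ≤ 1 - t ^ k := fun k ↦ sub_nonneg.2 (pow_le_one₀ hmem.1 hmem.2)
  split_ifs with h
  · have hr1 : 1 ≤ r := by
      rw [hr, ht, ← Real.exp_add, Real.one_le_exp_iff]
      have := sq_le_sq' (by linarith [abs_nonneg x]) h
      rw [sq_abs] at this
      linarith
    suffices Tendsto (fun k : ℕ ↦ (1 - t ^ k) ^ ⌈k * Real.exp (k * (c ^ 2 / 2))⌉₊) atTop (𝓝 0) by
      simpa using this.const_sub 1
    refine squeeze_zero (fun k ↦ pow_nonneg (hbase k) _) (fun k ↦ ?_)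
      (Real.tendsto_exp_neg_atTop_nhds_zero.comp tendsto_natCast_atTop_atTop)
    calc (1 - t ^ k) ^ ⌈k * Real.exp (k * (c ^ 2 / 2))⌉₊
        ≤ Real.exp (-t ^ k) ^ ⌈k * Real.exp (k * (c ^ 2 / 2))⌉₊ :=
          pow_le_pow_left₀ (hbase k) (Real.one_sub_le_exp_neg _) _
      _ = Real.exp (-(⌈k * Real.exp (k * (c ^ 2 / 2))⌉₊ * t ^ k)) := by
          rw [← Real.exp_nat_mul]
          ring_nf
      _ ≤ Real.exp (-k) := by
          rw [Real.exp_le_exp, neg_le_neg_iff]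
          calc (k : ℝ) ≤ k * r ^ k := le_mul_of_one_le_right (Nat.cast_nonneg _) (one_le_pow₀ hr1)
            _ = k * Real.exp (k * (c ^ 2 / 2)) * t ^ k := (hrk k).symm
            _ ≤ _ := mul_le_mul_of_nonneg_right (Nat.le_ceil _) (pow_nonneg hmem.1 k)
  · have hr1 : r < 1 := by
      rw [hr, ht, ← Real.exp_add, Real.exp_lt_one_iff]
      have := pow_lt_pow_left₀ (not_le.1 h) hc two_ne_zero
      rw [sq_abs] at this
      linarith
    have ht1 : t < 1 := by
      rw [ht, Real.exp_lt_one_iff]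
      have : 0 < |x| := hc.trans_lt (not_le.1 h)
      have := pow_pos this 2
      rw [sq_abs] at this
      linarith
    have hr0 : 0 ≤ r := by positivity
    refine squeeze_zero (fun k ↦ ?_) (fun k ↦ ?_) (g := fun k : ℕ ↦ k * r ^ k + t ^ k) ?_
    · have := pow_le_one₀ (n := ⌈k * Real.exp (k * (c ^ 2 / 2))⌉₊) (hbase k)
        (by linarith [pow_nonneg hmem.1 k])
      linarith
    · have h1 := one_add_mul_le_pow (a := -t ^ k) (by linarith [hbase k])
        ⌈k * Real.exp (k * (c ^ 2 / 2))⌉₊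
      have h2 : (⌈k * Real.exp (k * (c ^ 2 / 2))⌉₊ : ℝ) * t ^ k ≤ k * r ^ k + t ^ k := by
        rw [← hrk]
        have := (Nat.ceil_lt_add_one
          (by positivity : (0 : ℝ) ≤ k * Real.exp (k * (c ^ 2 / 2)))).le
        have := mul_le_mul_of_nonneg_right this (pow_nonneg hmem.1 k)
        linarith
      rw [← sub_eq_add_neg] at h1
      linarith
    · simpa using (tendsto_self_mul_const_pow_of_lt_one hr0 hr1).add
        (tendsto_pow_atTop_nhds_zero_of_lt_one hmem.1 ht1)

open Matrix Filter Topology in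
lemma tendsto_integral_prod_eval_slabPoly {m o : Type*} [Fintype m] [Fintype o] [DecidableEq o]
    (R : Matrix m o ℝ) {c : m → ℝ} (hc : ∀ i, 0 ≤ c i) {ρ : Measure (EuclideanSpace ℝ o)}
    [IsFiniteMeasure ρ] :
    Tendsto (fun k ↦ ∫ z, ∏ i, (slabPoly (c i) k).eval (Real.exp (-((R *ᵥ z.ofLp) i ^ 2 / 2))) ∂ρ)
      atTop (𝓝 (ρ.real {z | ∀ i, |(R *ᵥ z.ofLp) i| ≤ c i})) := by
  have hmeas : MeasurableSet {z : EuclideanSpace ℝ o | ∀ i, |(R *ᵥ z.ofLp) i| ≤ c i} := by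
    rw [Set.ofPred_forall]
    exact (isClosed_iInter fun i ↦ isClosed_le (by fun_prop) (by fun_prop)).measurableSet
  rw [← integral_indicator_one hmeas]
  refine tendsto_integral_of_dominated_convergence (fun _ ↦ 1)
    (fun k ↦ Continuous.aestronglyMeasurable (by fun_prop)) (integrable_const _)
    (fun k ↦ Eventually.of_forall fun z ↦ ?_) (Eventually.of_forall fun z ↦ ?_)
  · have := fun i ↦ eval_slabPoly_mem_Icc (c i) k (exp_neg_sq_mem_Icc ((R *ᵥ z.ofLp) i))
    rw [Real.norm_of_nonneg (Finset.prod_nonneg fun i _ ↦ (this i).1)]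
    exact Finset.prod_le_one (fun i _ ↦ (this i).1) fun i _ ↦ (this i).2
  · have h := tendsto_finsetProd Finset.univ fun i _ ↦
      tendsto_eval_slabPoly (hc i) ((R *ᵥ z.ofLp) i)
    rw [Finset.prod_ite_zero] at h
    simpa [Set.indicator_apply] using h

open Matrix in
/-- The Gaussian correlation inequality for finite intersections of symmetric slabs. -/
lemma stdGaussian_slabs_mul_le {m n o : Type*} [Fintype m] [Fintype n] [Fintype o] [DecidableEq o]
    (R : Matrix m o ℝ) (S : Matrix n o ℝ) {c : m → ℝ} {d : n → ℝ} (hc : ∀ i, 0 ≤ c i)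
    (hd : ∀ i, 0 ≤ d i) :
    (stdGaussian (EuclideanSpace ℝ o)).real {z | ∀ i, |(R *ᵥ z.ofLp) i| ≤ c i} *
      (stdGaussian (EuclideanSpace ℝ o)).real {z | ∀ i, |(S *ᵥ z.ofLp) i| ≤ d i} ≤
    (stdGaussian (EuclideanSpace ℝ o)).real
      ({z | ∀ i, |(R *ᵥ z.ofLp) i| ≤ c i} ∩ {z | ∀ i, |(S *ᵥ z.ofLp) i| ≤ d i}) := by
  classical
  have h3 := tendsto_integral_prod_eval_slabPoly (fromRows R S) (c := Sum.elim c d)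
    (by rintro (i | i); exacts [hc i, hd i]) (ρ := stdGaussian (EuclideanSpace ℝ o))
  simp only [fromRows_mulVec, Sum.forall, Sum.elim_inl, Sum.elim_inr, Fintype.prod_sum_type] at h3
  refine le_of_tendsto_of_tendsto' ((tendsto_integral_prod_eval_slabPoly R hc).mul
    (tendsto_integral_prod_eval_slabPoly S hd)) h3 fun k ↦ ?_
  exact integral_prod_eval_mul_le R S
    (fun i t ht ↦ (eval_slabPoly_mem_Icc _ _ ht).1)
    (fun i t ht ↦ eval_derivative_slabPoly_nonneg _ _ ht)
    (fun i t ht ↦ (eval_slabPoly_mem_Icc _ _ ht).1)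
    (fun i t ht ↦ eval_derivative_slabPoly_nonneg _ _ ht)

open Matrix in
lemma exists_slabs_iInter_eq {o : Type*} [Fintype o] [DecidableEq o]
    {A : Set (EuclideanSpace ℝ o)} (hA : Convex ℝ A) (hsymm : ∀ x ∈ A, -x ∈ A)
    (hclosed : IsClosed A) (hne : A.Nonempty) :
    ∃ (R : ℕ → o → ℝ) (c : ℕ → ℝ), (∀ i, 0 ≤ c i) ∧
      ⋂ N : ℕ, {z : EuclideanSpace ℝ o | ∀ i : Fin N,
        |(Matrix.of (fun i : Fin N ↦ R i) *ᵥ z.ofLp) i| ≤ c i} = A := by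
  obtain ⟨l, c, hlc⟩ := RCLike.iInter_countable_halfSpaces_eq (𝕜 := ℝ) hA hclosed
  simp only [RCLike.re_to_real] at hlc
  have h0 : (0 : EuclideanSpace ℝ o) ∈ A := by
    obtain ⟨x, hx⟩ := hne
    have := hA hx (hsymm x hx) (by norm_num : (0 : ℝ) ≤ 1 / 2) (by norm_num : (0 : ℝ) ≤ 1 / 2)
      (by norm_num)
    simpa using this
  refine ⟨fun n j ↦ l n (EuclideanSpace.single j 1), c, fun i ↦ ?_, ?_⟩
  · rw [← hlc, Set.mem_iInter] at h0
    simpa using h0 i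
  · have hl : ∀ n (z : EuclideanSpace ℝ o),
        ((fun j ↦ l n (EuclideanSpace.single j 1)) ⬝ᵥ z.ofLp) = l n z := by
      intro n z
      conv_rhs => rw [← (EuclideanSpace.basisFun o ℝ).sum_repr z]
      simp [dotProduct, mul_comm]
    ext z
    simp only [Set.mem_iInter, Set.mem_ofPred_eq, mulVec, Matrix.of_apply, hl]
    constructor
    · intro h
      rw [← hlc, Set.mem_iInter]
      exact fun n ↦ (le_abs_self _).trans (h (n + 1) ⟨n, n.lt_succ_self⟩)
    · intro h N i
      have h' := hsymm z h
      rw [← hlc, Set.mem_iInter] at h h'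
      have h1 : l i z ≤ c i := h i
      have h2 : l i (-z) ≤ c i := h' i
      rw [map_neg] at h2
      exact abs_le.2 ⟨by linarith, h1⟩

open Matrix Filter Topology in
lemma stdGaussian_mul_le_of_isClosed {o : Type*} [Fintype o] [DecidableEq o]
    {A B : Set (EuclideanSpace ℝ o)}
    (hA : Convex ℝ A) (hAs : ∀ x ∈ A, -x ∈ A) (hAc : IsClosed A)
    (hB : Convex ℝ B) (hBs : ∀ x ∈ B, -x ∈ B) (hBc : IsClosed B) :
    (stdGaussian (EuclideanSpace ℝ o)).real A * (stdGaussian (EuclideanSpace ℝ o)).real B ≤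
      (stdGaussian (EuclideanSpace ℝ o)).real (A ∩ B) := by
  rcases A.eq_empty_or_nonempty with rfl | hAn
  · simp
  rcases B.eq_empty_or_nonempty with rfl | hBn
  · simp
  obtain ⟨R, c, hc, hRA⟩ := exists_slabs_iInter_eq hA hAs hAc hAn
  obtain ⟨S, d, hd, hSB⟩ := exists_slabs_iInter_eq hB hBs hBc hBn
  have hclosed : ∀ (R : ℕ → o → ℝ) (c : ℕ → ℝ) (N : ℕ), IsClosed
      {z : EuclideanSpace ℝ o | ∀ i : Fin N,
        |(Matrix.of (fun i : Fin N ↦ R i) *ᵥ z.ofLp) i| ≤ c i} := by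
    intro R c N
    rw [Set.ofPred_forall]
    exact isClosed_iInter fun i ↦ isClosed_le (by fun_prop) (by fun_prop)
  have hanti : ∀ (R : ℕ → o → ℝ) (c : ℕ → ℝ), Antitone fun N : ℕ ↦
      {z : EuclideanSpace ℝ o | ∀ i : Fin N,
        |(Matrix.of (fun i : Fin N ↦ R i) *ᵥ z.ofLp) i| ≤ c i} :=
    fun R c N M hNM z hz i ↦ hz (Fin.castLE hNM i)
  have hlim : ∀ s : ℕ → Set (EuclideanSpace ℝ o), Antitone s → (∀ N, IsClosed (s N)) →
      Tendsto (fun N ↦ (stdGaussian (EuclideanSpace ℝ o)).real (s N)) atTop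
        (𝓝 ((stdGaussian (EuclideanSpace ℝ o)).real (⋂ N, s N))) := fun s hs hsc ↦
    (ENNReal.tendsto_toReal (measure_ne_top _ _)).comp
      (tendsto_measure_iInter_atTop (fun N ↦ (hsc N).measurableSet.nullMeasurableSet) hs
        ⟨0, measure_ne_top _ _⟩)
  have h3 := hlim _ ((hanti R c).inf (hanti S d)) fun N ↦ (hclosed R c N).inter (hclosed S d N)
  simp only [Pi.inf_apply, Set.inf_eq_inter] at h3
  rw [Set.iInter_inter_distrib, hRA, hSB] at h3
  have h1 := hlim _ (hanti R c) (hclosed R c)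
  have h2 := hlim _ (hanti S d) (hclosed S d)
  rw [hRA] at h1
  rw [hSB] at h2
  exact le_of_tendsto_of_tendsto' (h1.mul h2) h3 fun N ↦
    stdGaussian_slabs_mul_le _ _ (fun i ↦ hc i) fun i ↦ hd i

lemma absolutelyContinuous_pi_fin {k : ℕ} {ρ ν : Measure ℝ} [SigmaFinite ρ] [SigmaFinite ν]
    (h : ρ ≪ ν) : Measure.pi (fun _ : Fin k ↦ ρ) ≪ Measure.pi fun _ : Fin k ↦ ν := by
  induction k with
  | zero => rw [Measure.pi_of_empty, Measure.pi_of_empty]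
  | succ k ih =>
    have hρ := (measurePreserving_piFinSuccAbove (fun _ : Fin (k + 1) ↦ ρ) 0).symm
    have hν := (measurePreserving_piFinSuccAbove (fun _ : Fin (k + 1) ↦ ν) 0).symm
    rw [← hρ.map_eq, ← hν.map_eq]
    exact (h.prod ih).map (MeasurableEquiv.measurable _)

lemma stdGaussian_frontier {k : ℕ} {A : Set (EuclideanSpace ℝ (Fin k))} (hA : Convex ℝ A) :
    stdGaussian (EuclideanSpace ℝ (Fin k)) (frontier A) = 0 := by
  let e := (PiLp.continuousLinearEquiv 2 ℝ fun _ : Fin k ↦ ℝ).symm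
  have he : ⇑e = WithLp.toLp 2 := rfl
  rw [← map_pi_eq_stdGaussian, ← he, Measure.map_apply e.continuous.measurable
    isClosed_frontier.measurableSet]
  refine absolutelyContinuous_pi_fin (gaussianReal_absolutelyContinuous 0 one_ne_zero) ?_
  have h2 := e.toHomeomorph.preimage_frontier A
  have h3 : Convex ℝ (e.toHomeomorph ⁻¹' A) := hA.linear_preimage e.toLinearMap
  have := h3.addHaar_frontier (μ := volume)
  rwa [← h2] at this

/-- The **Gaussian correlation inequality** for the standard Gaussian measure on `ℝᵏ`. -/
lemma stdGaussian_mul_le {k : ℕ} {A B : Set (EuclideanSpace ℝ (Fin k))}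
    (hA : Convex ℝ A) (hAs : ∀ x ∈ A, -x ∈ A) (hB : Convex ℝ B) (hBs : ∀ x ∈ B, -x ∈ B) :
    (stdGaussian (EuclideanSpace ℝ (Fin k))).real A *
      (stdGaussian (EuclideanSpace ℝ (Fin k))).real B ≤
      (stdGaussian (EuclideanSpace ℝ (Fin k))).real (A ∩ B) := by
  have hae : ∀ {S : Set (EuclideanSpace ℝ (Fin k))}, Convex ℝ S →
      closure S =ᵐ[stdGaussian (EuclideanSpace ℝ (Fin k))] S := fun hS ↦
    closure_ae_eq_of_null_frontier (stdGaussian_frontier hS)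
  have hsymm : ∀ {S : Set (EuclideanSpace ℝ (Fin k))}, (∀ x ∈ S, -x ∈ S) →
      ∀ x ∈ closure S, -x ∈ closure S := fun hS x hx ↦
    map_mem_closure continuous_neg hx hS
  have := stdGaussian_mul_le_of_isClosed hA.closure (hsymm hAs) isClosed_closure
    hB.closure (hsymm hBs) isClosed_closure
  rwa [measureReal_congr (hae hA), measureReal_congr (hae hB),
    measureReal_congr ((hae hA).inter (hae hB))] at this

lemma exists_cylinder_measure_symmDiff_lt {X : Type*} [NormedAddCommGroup X] [NormedSpace ℝ X]
    [SecondCountableTopology X] [MeasurableSpace X] [BorelSpace X] (ν : Measure X)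
    [IsFiniteMeasure ν] {A : Set X} (hA : MeasurableSet A) {ε : ℝ} (hε : 0 < ε) :
    ∃ (F : Finset (StrongDual ℝ X)) (C : Set X), MeasurableSet C ∧
      (∀ x y, (∀ L ∈ F, L x = L y) → (x ∈ C ↔ y ∈ C)) ∧ ν.real (symmDiff C A) < ε := by
  classical
  set 𝒞 : Set (Set X) := {C | MeasurableSet C ∧ ∃ F : Finset (StrongDual ℝ X),
    ∀ x y, (∀ L ∈ F, L x = L y) → (x ∈ C ↔ y ∈ C)} with h𝒞
  have hring : IsSetRing 𝒞 := by
    refine ⟨⟨.empty, ∅, by simp⟩, ?_, ?_⟩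
    · rintro s t ⟨hs, F, hF⟩ ⟨ht, G, hG⟩
      refine ⟨hs.union ht, F ∪ G, fun x y h ↦ ?_⟩
      rw [Set.mem_union, Set.mem_union, hF x y fun L hL ↦ h L (Finset.mem_union_left _ hL),
        hG x y fun L hL ↦ h L (Finset.mem_union_right _ hL)]
    · rintro s t ⟨hs, F, hF⟩ ⟨ht, G, hG⟩
      refine ⟨hs.diff ht, F ∪ G, fun x y h ↦ ?_⟩
      rw [Set.mem_sdiff, Set.mem_sdiff, hF x y fun L hL ↦ h L (Finset.mem_union_left _ hL),
        hG x y fun L hL ↦ h L (Finset.mem_union_right _ hL)]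
  have hball : ∀ (x : X) (r : ℝ), MeasurableSet[MeasurableSpace.generateFrom 𝒞]
      (Metric.closedBall x r) := by
    intro x r
    obtain ⟨l, c, hlc⟩ := RCLike.iInter_countable_halfSpaces_eq (𝕜 := ℝ)
      (convex_closedBall x r) Metric.isClosed_closedBall
    simp only [RCLike.re_to_real] at hlc
    rw [← hlc]
    refine MeasurableSet.iInter fun n ↦ MeasurableSpace.measurableSet_generateFrom
      ⟨(isClosed_le (by fun_prop) (by fun_prop)).measurableSet, {l n}, fun y z h ↦ ?_⟩
    simp [h (l n) (by simp)]
  have hgen : ‹MeasurableSpace X› = MeasurableSpace.generateFrom 𝒞 := by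
    refine le_antisymm ?_ (MeasurableSpace.generateFrom_le fun t ht ↦ ht.1)
    rw [BorelSpace.measurable_eq (α := X)]
    refine MeasurableSpace.generateFrom_le fun U (hU : IsOpen U) ↦ ?_
    have hr : ∀ x : U, ∃ r > 0, Metric.closedBall (x : X) r ⊆ U := fun x ↦
      Metric.nhds_basis_closedBall.mem_iff.1 (hU.mem_nhds x.2)
    choose r hr0 hrU using hr
    obtain ⟨T, hT, hTU⟩ := TopologicalSpace.isOpen_iUnion_countable
      (fun x : U ↦ Metric.ball (x : X) (r x)) fun x ↦ Metric.isOpen_ball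
    have hU : U = ⋃ x ∈ T, Metric.closedBall (x : X) (r x) := by
      refine Set.Subset.antisymm (fun x hx ↦ ?_) (Set.iUnion₂_subset fun x _ ↦ hrU x)
      have : x ∈ ⋃ x ∈ T, Metric.ball (x : X) (r x) := by
        rw [hTU]
        exact Set.mem_iUnion.2 ⟨⟨x, hx⟩, Metric.mem_ball_self (hr0 _)⟩
      exact Set.iUnion₂_mono (fun x _ ↦ Metric.ball_subset_closedBall) this
    rw [hU]
    exact MeasurableSet.biUnion hT fun x _ ↦ hball x (r x)
  obtain ⟨C, ⟨hC, F, hF⟩, hCA⟩ := exists_measure_symmDiff_lt_of_generateFrom_isSetRing (μ := ν)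
    hring ⟨{Set.univ}, by simp, by simp [h𝒞], by simp⟩ hgen hA (ENNReal.ofReal_pos.2 hε)
  exact ⟨F, C, hC, hF, (ENNReal.lt_ofReal_iff_toReal_lt (measure_ne_top _ _)).1 hCA⟩

lemma norm_sub_sum_inner_smul_sq {ι E : Type*} [Fintype ι] [NormedAddCommGroup E]
    [InnerProductSpace ℝ E] {b : ι → E} (hb : Orthonormal ℝ b) (v : E) :
    ‖v - ∑ i, inner ℝ (b i) v • b i‖ ^ 2 = ‖v‖ ^ 2 - ∑ i, inner ℝ (b i) v ^ 2 := by
  have h1 := hb.inner_sum (fun i ↦ inner ℝ (b i) v) (fun i ↦ inner ℝ (b i) v) Finset.univ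
  have h2 : inner ℝ v (∑ i, inner ℝ (b i) v • b i) = ∑ i, inner ℝ (b i) v ^ 2 := by
    simp_rw [inner_sum, inner_smul_right, real_inner_comm v, sq]
  rw [norm_sub_sq_real, h2, ← real_inner_self_eq_norm_sq (∑ i, _), h1]
  simp_rw [conj_trivial, ← sq]
  ring

/-- Regression of a centered Gaussian measure on finitely many functionals: up to the law, a
Gaussian vector is the sum of a finite-dimensional one determining these functionals and of an
independent remainder on which they vanish. -/
lemma exists_measurePreserving_stdGaussian_prod {X : Type*} [NormedAddCommGroup X]
    [NormedSpace ℝ X] [CompleteSpace X] [SecondCountableTopology X] [MeasurableSpace X]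
    [BorelSpace X] (ν : Measure X) [IsGaussian ν] (hν : ∀ L : StrongDual ℝ X, ∫ x, L x ∂ν = 0)
    (F : Finset (StrongDual ℝ X)) :
    ∃ (k : ℕ) (E : EuclideanSpace ℝ (Fin k) →L[ℝ] X) (r : X →L[ℝ] X),
      MeasurePreserving (fun p : EuclideanSpace ℝ (Fin k) × X ↦ E p.1 + r p.2)
        ((stdGaussian (EuclideanSpace ℝ (Fin k))).prod ν) ν ∧
      ∀ L ∈ F, ∀ᵐ x ∂ν, L (r x) = 0 := by
  have hmem : MemLp id 2 ν := IsGaussian.memLp_two_id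
  set T := StrongDual.toLp (𝕜 := ℝ) ν 2 with hT
  have hTinner : ∀ L M : StrongDual ℝ X, inner ℝ (T L) (T M) = ∫ x, L x * M x ∂ν :=
    fun L M ↦ uncenteredCovarianceBilinDual_apply hmem L M
  have hTvar : ∀ L : StrongDual ℝ X, Var[L; ν] = ‖T L‖ ^ 2 := by
    intro L
    rw [variance_of_integral_eq_zero (by fun_prop) (hν L), ← real_inner_self_eq_norm_sq, hTinner]
    simp_rw [sq]
  set W := (Submodule.span ℝ (F : Set (StrongDual ℝ X))).map T.toLinearMap with hW
  set b := stdOrthonormalBasis ℝ W with hb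
  have hbM : ∀ i, ∃ M : StrongDual ℝ X, T M = b i := fun i ↦ by
    obtain ⟨M, -, hM⟩ := (b i).2
    exact ⟨M, hM⟩
  choose M hM using hbM
  have hortho : Orthonormal ℝ fun i ↦ (b i : Lp ℝ 2 ν) :=
    b.orthonormal.comp_linearIsometry W.subtypeₗᵢ
  set e : Fin (Module.finrank ℝ W) → X := fun i ↦ ∫ x, M i x • x ∂ν with he
  have hLe : ∀ (L : StrongDual ℝ X) i, L (e i) = inner ℝ (b i : Lp ℝ 2 ν) (T L) := by
    intro L i
    have hintegr : Integrable (fun x ↦ M i x • x) ν :=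
      memLp_one_iff_integrable.1 (hmem.smul (hmem.continuousLinearMap_comp (M i)))
    rw [he, ← hM, hTinner, ← L.integral_comp_comm hintegr]
    simp
  let E : EuclideanSpace ℝ (Fin (Module.finrank ℝ W)) →L[ℝ] X :=
    ∑ i, (EuclideanSpace.proj i).smulRight (e i)
  let r : X →L[ℝ] X := ContinuousLinearMap.id ℝ X - ∑ i, (M i).smulRight (e i)
  have hTr : ∀ L : StrongDual ℝ X,
      T (L ∘SL r) = T L - ∑ i, inner ℝ (b i : Lp ℝ 2 ν) (T L) • (b i : Lp ℝ 2 ν) := by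
    intro L
    have : L ∘SL r = L - ∑ i, L (e i) • M i := by
      ext x
      simp [r, mul_comm]
    rw [this, map_sub, map_sum]
    simp_rw [map_smul, hLe, hM]
  refine ⟨_, E, r, ⟨by fun_prop, ?_⟩, fun L hL ↦ ?_⟩
  · refine Measure.ext_of_charFunDual ?_
    ext L
    have hcoe : (fun p : EuclideanSpace ℝ (Fin (Module.finrank ℝ W)) × X ↦ E p.1 + r p.2) =
      ⇑(E.coprod r) := by ext p; simp
    have hL1 : (L ∘SL E.coprod r) ∘SL ContinuousLinearMap.inl ℝ _ X = L ∘SL E := by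
      ext z; simp
    have hL2 : (L ∘SL E.coprod r) ∘SL
        ContinuousLinearMap.inr ℝ (EuclideanSpace ℝ (Fin (Module.finrank ℝ W))) X = L ∘SL r := by
      ext z; simp
    have hnorm : ‖L ∘SL E‖ ^ 2 = ∑ i, inner ℝ (b i : Lp ℝ 2 ν) (T L) ^ 2 := by
      rw [(EuclideanSpace.basisFun _ ℝ).norm_dual]
      refine Finset.sum_congr rfl fun i _ ↦ ?_
      rw [← hLe]
      simp [E]
    rw [hcoe, charFunDual_map, charFunDual_prod, hL1, hL2, charFunDual_stdGaussian,
      IsGaussian.charFunDual_eq_of_forall_strongDual_eq_zero hν,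
      IsGaussian.charFunDual_eq_of_forall_strongDual_eq_zero hν, ← Complex.exp_add, hTvar, hTvar,
      hTr, norm_sub_sum_inner_smul_sq hortho, ← hnorm]
    congr 1
    push_cast
    ring
  · have hTL : T L ∈ W := ⟨L, Submodule.subset_span hL, rfl⟩
    have h0 : T (L ∘SL r) = 0 := by
      rw [hTr]
      have := congrArg (Subtype.val) (b.sum_repr' ⟨T L, hTL⟩)
      simp only [Submodule.coe_sum, Submodule.coe_smul, Submodule.coe_inner] at this
      rw [this, sub_self]
    have h1 : T (L ∘SL r) =ᵐ[ν] L ∘SL r := by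
      rw [hT, StrongDual.toLp_apply hmem]
      exact MemLp.coeFn_toLp _
    rw [h0] at h1
    filter_upwards [h1, Lp.coeFn_zero ℝ 2 ν] with x hx hx0
    simpa [hx0] using hx.symm

lemma integrable_measureReal_prodMk {Z X : Type*} [MeasurableSpace Z] [MeasurableSpace X]
    (γ : Measure Z) [IsProbabilityMeasure γ] (ν : Measure X) [IsProbabilityMeasure ν]
    {s : Set (Z × X)} (hs : MeasurableSet s) :
    Integrable (fun x ↦ γ.real ((fun z ↦ (z, x)) ⁻¹' s)) ν := by
  refine Integrable.of_bound (C := 1)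
    (measurable_measure_prodMk_right hs).ennreal_toReal.aestronglyMeasurable ?_
  refine Filter.Eventually.of_forall fun x ↦ ?_
  rw [Real.norm_of_nonneg measureReal_nonneg]
  exact measureReal_le_one

lemma integral_measureReal_prodMk {Z X : Type*} [MeasurableSpace Z] [MeasurableSpace X]
    (γ : Measure Z) [IsProbabilityMeasure γ] (ν : Measure X) [IsProbabilityMeasure ν]
    {s : Set (Z × X)} (hs : MeasurableSet s) :
    ∫ x, γ.real ((fun z ↦ (z, x)) ⁻¹' s) ∂ν = (γ.prod ν).real s := by
  rw [measureReal_def, Measure.prod_apply_symm hs, ← integral_toReal]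
  · rfl
  · exact (measurable_measure_prodMk_right hs).aemeasurable
  · exact Filter.Eventually.of_forall fun x ↦ measure_lt_top _ _

lemma measurePreserving_neg_of_isGaussian {X : Type*} [NormedAddCommGroup X]
    [NormedSpace ℝ X] [CompleteSpace X] [SecondCountableTopology X] [MeasurableSpace X]
    [BorelSpace X] (ν : Measure X) [IsGaussian ν] (hν : ∀ L : StrongDual ℝ X, ∫ x, L x ∂ν = 0) :
    MeasurePreserving (fun x ↦ -x) ν ν := by
  refine ⟨measurable_neg, Measure.ext_of_charFunDual ?_⟩
  ext L
  have hcoe : (fun x : X ↦ -x) = ⇑(-ContinuousLinearMap.id ℝ X) := by ext; simp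
  have hL : L ∘SL (-ContinuousLinearMap.id ℝ X) = -L := by ext; simp
  rw [hcoe, charFunDual_map, hL, IsGaussian.charFunDual_eq_of_forall_strongDual_eq_zero hν,
    IsGaussian.charFunDual_eq_of_forall_strongDual_eq_zero hν, FunLike.coe_neg, variance_neg]

/-- If a set is close to a cylinder, then most of its sections are close to the basis of the
cylinder. -/
lemma exists_integrable_sub_le_measureReal_section {Z X : Type*} [NormedAddCommGroup Z]
    [NormedSpace ℝ Z] [MeasurableSpace Z] [BorelSpace Z] [NormedAddCommGroup X] [NormedSpace ℝ X]
    [SecondCountableTopology X] [MeasurableSpace X] [BorelSpace X]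
    {γ : Measure Z} [IsProbabilityMeasure γ] {ν : Measure X} [IsProbabilityMeasure ν]
    (hneg : MeasurePreserving (fun x ↦ -x) ν ν) {E : Z →L[ℝ] X} {r : X →L[ℝ] X}
    (hEr : MeasurePreserving (fun p : Z × X ↦ E p.1 + r p.2) (γ.prod ν) ν)
    {F : Finset (StrongDual ℝ X)} (hF : ∀ L ∈ F, ∀ᵐ x ∂ν, L (r x) = 0) {A C : Set X}
    (hA : MeasurableSet A) (hC : MeasurableSet C)
    (hCF : ∀ x y, (∀ L ∈ F, L x = L y) → (x ∈ C ↔ y ∈ C)) :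
    ∃ δ : X → ℝ, Integrable δ ν ∧ (∀ x, 0 ≤ δ x) ∧ ∫ x, δ x ∂ν ≤ 2 * ν.real (symmDiff C A) ∧
      ∀ᵐ x ∂ν, ν.real C - δ x ≤ γ.real {z | E z + r x ∈ A ∧ E z - r x ∈ A} := by
  have hEr' : MeasurePreserving (fun p : Z × X ↦ E p.1 - r p.2) (γ.prod ν) ν := by
    have := hEr.comp ((MeasurePreserving.id γ).prod hneg)
    convert this using 2 with p
    simp [sub_eq_add_neg]
  have hF' : ∀ᵐ x ∂ν, ∀ L ∈ F, L (r x) = 0 := (Finset.eventually_all F).2 hF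
  have hCp : ∀ᵐ x ∂ν, ∀ z, (E z + r x ∈ C ↔ E z ∈ C) ∧ (E z - r x ∈ C ↔ E z ∈ C) := by
    filter_upwards [hF'] with x hx z
    exact ⟨hCF _ _ fun L hL ↦ by simp [hx L hL], hCF _ _ fun L hL ↦ by simp [hx L hL]⟩
  have hνC : ν.real C = γ.real (E ⁻¹' C) := by
    rw [← hEr.measureReal_preimage hC.nullMeasurableSet,
      ← integral_measureReal_prodMk γ ν (hEr.measurable hC)]
    have : (fun x ↦ γ.real ((fun z ↦ (z, x)) ⁻¹' ((fun p : Z × X ↦ E p.1 + r p.2) ⁻¹' C))) =ᵐ[ν]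
        fun _ ↦ γ.real (E ⁻¹' C) := by
      filter_upwards [hCp] with x hx
      congr 1
      ext z
      exact (hx z).1
    rw [integral_congr_ae this]
    simp
  have hm1 := hEr.measurable (hC.diff hA)
  have hm2 := hEr'.measurable (hC.diff hA)
  refine ⟨fun x ↦ γ.real ((fun z ↦ (z, x)) ⁻¹' ((fun p : Z × X ↦ E p.1 + r p.2) ⁻¹' (C \ A))) +
      γ.real ((fun z ↦ (z, x)) ⁻¹' ((fun p : Z × X ↦ E p.1 - r p.2) ⁻¹' (C \ A))),
    (integrable_measureReal_prodMk γ ν hm1).add (integrable_measureReal_prodMk γ ν hm2),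
    fun x ↦ add_nonneg measureReal_nonneg measureReal_nonneg, ?_, ?_⟩
  · rw [integral_add (integrable_measureReal_prodMk γ ν hm1)
      (integrable_measureReal_prodMk γ ν hm2), integral_measureReal_prodMk γ ν hm1,
      integral_measureReal_prodMk γ ν hm2,
      hEr.measureReal_preimage (hC.diff hA).nullMeasurableSet,
      hEr'.measureReal_preimage (hC.diff hA).nullMeasurableSet, ← two_mul]
    exact mul_le_mul_of_nonneg_left (measureReal_mono Set.subset_union_left) zero_le_two
  · filter_upwards [hCp] with x hx
    rw [hνC, sub_le_iff_le_add]
    refine (measureReal_mono ?_).trans ((measureReal_union_le _ _).trans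
      (add_le_add_right (measureReal_union_le _ _) _))
    intro z hz
    by_cases h1 : E z + r x ∈ A
    · by_cases h2 : E z - r x ∈ A
      · exact Or.inl ⟨h1, h2⟩
      · exact Or.inr (Or.inr ⟨(hx z).2.2 hz, h2⟩)
    · exact Or.inr (Or.inl ⟨(hx z).1.2 hz, h1⟩)

/-- The **Gaussian correlation inequality** for centered Gaussian measures on separable Banach
spaces. -/
theorem ProbabilityTheory.IsGaussian.measureReal_mul_le {X : Type*} [NormedAddCommGroup X]
    [NormedSpace ℝ X] [CompleteSpace X] [SecondCountableTopology X] [MeasurableSpace X]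
    [BorelSpace X] (ν : Measure X) [IsGaussian ν] (hν : ∀ L : StrongDual ℝ X, ∫ x, L x ∂ν = 0)
    {A B : Set X} (hA : MeasurableSet A) (hAc : Convex ℝ A) (hAs : ∀ x ∈ A, -x ∈ A)
    (hB : MeasurableSet B) (hBc : Convex ℝ B) (hBs : ∀ x ∈ B, -x ∈ B) :
    ν.real A * ν.real B ≤ ν.real (A ∩ B) := by
  classical
  refine le_of_forall_pos_le_add fun ε hε ↦ ?_
  have hη : 0 < ε / 6 := by positivity
  obtain ⟨F, C, hC, hCF, hCA⟩ := exists_cylinder_measure_symmDiff_lt ν hA hη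
  obtain ⟨G, D, hD, hDG, hDB⟩ := exists_cylinder_measure_symmDiff_lt ν hB hη
  obtain ⟨k, E, r, hEr, hFG⟩ := exists_measurePreserving_stdGaussian_prod ν hν (F ∪ G)
  set γ := stdGaussian (EuclideanSpace ℝ (Fin k)) with hγ
  have hneg := measurePreserving_neg_of_isGaussian ν hν
  obtain ⟨δ, hδi, hδ0, hδ, hδA⟩ := exists_integrable_sub_le_measureReal_section hneg hEr hFG hA hC
    fun x y h ↦ hCF x y fun L hL ↦ h L (Finset.mem_union_left _ hL)
  obtain ⟨δ', hδi', hδ0', hδ', hδB⟩ := exists_integrable_sub_le_measureReal_section hneg hEr hFG hB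
    hD fun x y h ↦ hDG x y fun L hL ↦ h L (Finset.mem_union_right _ hL)
  have hsec : ∀ (S : Set X), Convex ℝ S → ∀ x,
      Convex ℝ {z : EuclideanSpace ℝ (Fin k) | E z + r x ∈ S ∧ E z - r x ∈ S} := by
    intro S hS x
    have h1 := (hS.translate_preimage_right (r x)).linear_preimage E.toLinearMap
    have h2 := (hS.translate_preimage_right (-r x)).linear_preimage E.toLinearMap
    have h3 : {z : EuclideanSpace ℝ (Fin k) | E z + r x ∈ S ∧ E z - r x ∈ S} =
        E ⁻¹' ((fun y ↦ r x + y) ⁻¹' S) ∩ E ⁻¹' ((fun y ↦ -r x + y) ⁻¹' S) := by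
      ext z
      change (E z + r x ∈ S ∧ E z - r x ∈ S) ↔ (r x + E z ∈ S ∧ -r x + E z ∈ S)
      rw [add_comm (r x), neg_add_eq_sub]
    rw [h3]
    exact h1.inter h2
  have hsym : ∀ (S : Set X), (∀ x ∈ S, -x ∈ S) → ∀ x,
      ∀ z ∈ {z : EuclideanSpace ℝ (Fin k) | E z + r x ∈ S ∧ E z - r x ∈ S},
        -z ∈ {z : EuclideanSpace ℝ (Fin k) | E z + r x ∈ S ∧ E z - r x ∈ S} := by
    rintro S hS x z ⟨h1, h2⟩
    refine ⟨?_, ?_⟩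
    · convert hS _ h2 using 1
      rw [map_neg]
      abel
    · convert hS _ h1 using 1
      rw [map_neg]
      abel
  have hm := hEr.measurable (hA.inter hB)
  have hintegr := integrable_measureReal_prodMk γ ν hm
  have hae : (fun x ↦ ν.real C * ν.real D - δ x - δ' x) ≤ᵐ[ν] fun x ↦
      γ.real ((fun z ↦ (z, x)) ⁻¹' ((fun p : EuclideanSpace ℝ (Fin k) × X ↦
        E p.1 + r p.2) ⁻¹' (A ∩ B))) := by
    filter_upwards [hδA, hδB] with x h1 h2
    have h3 := stdGaussian_mul_le (hsec A hAc x) (hsym A hAs x) (hsec B hBc x) (hsym B hBs x)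
    have h4 : γ.real ({z | E z + r x ∈ A ∧ E z - r x ∈ A} ∩ {z | E z + r x ∈ B ∧ E z - r x ∈ B}) ≤
        γ.real ((fun z ↦ (z, x)) ⁻¹' ((fun p : EuclideanSpace ℝ (Fin k) × X ↦
          E p.1 + r p.2) ⁻¹' (A ∩ B))) :=
      measureReal_mono fun z hz ↦ ⟨hz.1.1, hz.2.1⟩
    refine le_trans ?_ (h3.trans h4)
    have ha0 : 0 ≤ γ.real {z | E z + r x ∈ A ∧ E z - r x ∈ A} := measureReal_nonneg
    have ha1 : γ.real {z | E z + r x ∈ A ∧ E z - r x ∈ A} ≤ 1 := measureReal_le_one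
    have hD0 : 0 ≤ ν.real D := measureReal_nonneg
    have hD1 : ν.real D ≤ 1 := measureReal_le_one
    have h5 := mul_le_mul_of_nonneg_left (sub_le_iff_le_add.1 h2) ha0
    have h6 := mul_le_mul_of_nonneg_right (sub_le_iff_le_add.1 h1) hD0
    have h7 := mul_le_mul_of_nonneg_right ha1 (hδ0' x)
    have h8 := mul_le_mul_of_nonneg_left hD1 (hδ0 x)
    rw [← hγ]
    linarith
  have hle := integral_mono_ae (((integrable_const _).sub hδi).sub hδi') hintegr hae
  rw [integral_measureReal_prodMk γ ν hm, hEr.measureReal_preimage (hA.inter hB).nullMeasurableSet,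
    integral_sub' ((integrable_const _).sub hδi) hδi', integral_sub' (integrable_const _) hδi,
    integral_const, probReal_univ, one_smul] at hle
  have hA' := abs_measureReal_sub_le_measureReal_symmDiff (μ := ν) hC.nullMeasurableSet
    hA.nullMeasurableSet
  have hB' := abs_measureReal_sub_le_measureReal_symmDiff (μ := ν) hD.nullMeasurableSet
    hB.nullMeasurableSet
  have hA1 := (abs_le.1 hA').1
  have hB1 := (abs_le.1 hB').1
  have h0 : 0 ≤ ν.real C := measureReal_nonneg
  have h1 : ν.real C ≤ 1 := measureReal_le_one
  have h2 : 0 ≤ ν.real B := measureReal_nonneg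
  have h3 : ν.real B ≤ 1 := measureReal_le_one
  have h4 : ν.real A * ν.real B ≤ (ν.real C + ε / 6) * ν.real B :=
    mul_le_mul_of_nonneg_right (by linarith) h2
  have h5 : ν.real C * ν.real B ≤ ν.real C * (ν.real D + ε / 6) :=
    mul_le_mul_of_nonneg_left (by linarith) h0
  have h6 : ε / 6 * ν.real B ≤ ε / 6 := mul_le_of_le_one_right hη.le h3
  have h7 : ν.real C * (ε / 6) ≤ ε / 6 := mul_le_of_le_one_left hη.le h1
  linarith

/-- Gaussian correlation inequality for a symmetric convex set and a symmetric quasi-concave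
function. -/
lemma ProbabilityTheory.IsGaussian.measure_mul_lintegral_le {X : Type*} [NormedAddCommGroup X]
    [NormedSpace ℝ X] [CompleteSpace X] [SecondCountableTopology X] [MeasurableSpace X]
    [BorelSpace X] (ν : Measure X) [IsGaussian ν] (hν : ∀ L : StrongDual ℝ X, ∫ x, L x ∂ν = 0)
    {A : Set X} (hA : MeasurableSet A) (hAc : Convex ℝ A) (hAs : ∀ x ∈ A, -x ∈ A)
    {h : X → ℝ} (hm : Measurable h) (h0 : ∀ x, 0 ≤ h x) (hqc : ∀ t > 0, Convex ℝ {x | t ≤ h x})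
    (hs : ∀ x, h (-x) = h x) :
    ν A * ∫⁻ x, ENNReal.ofReal (h x) ∂ν ≤ ∫⁻ x in A, ENNReal.ofReal (h x) ∂ν := by
  rw [lintegral_eq_lintegral_meas_le ν (Filter.Eventually.of_forall h0) hm.aemeasurable,
    lintegral_eq_lintegral_meas_le (ν.restrict A) (Filter.Eventually.of_forall h0) hm.aemeasurable,
    ← lintegral_const_mul' _ _ (measure_ne_top _ _)]
  refine setLIntegral_mono' measurableSet_Ioi fun t ht ↦ ?_
  have hlev : MeasurableSet {x | t ≤ h x} := measurableSet_le measurable_const hm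
  rw [Measure.restrict_apply hlev, Set.inter_comm]
  have := IsGaussian.measureReal_mul_le ν hν hA hAc hAs hlev (hqc t ht)
    fun x (hx : t ≤ h x) ↦ (hx.trans_eq (hs x).symm : t ≤ h (-x))
  rwa [measureReal_def, measureReal_def, measureReal_def, ← ENNReal.toReal_mul,
    ENNReal.toReal_le_toReal (ENNReal.mul_ne_top (measure_ne_top _ _) (measure_ne_top _ _))
      (measure_ne_top _ _)] at this

/-- Let `μ` be a centered Gaussian probability measure on a real
separable Banach space `X` and `f, g : X → ℝ` measurable with `e^f`, `e^{-g}`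
integrable.  If `f + g` is symmetric and quasi-concave and the normalized
reweighting `μ^{(-g)}` of `μ` by `e^{-g}` is again a centered Gaussian measure, then
for every symmetric convex measurable `A ⊆ X`, `μ^{(f)}(A) ≥ μ^{(-g)}(A)`, i.e.
`(∫_A e^f dμ)/(∫ e^f dμ) ≥ (∫_A e^{-g} dμ)/(∫ e^{-g} dμ)`. -/
theorem gci_reweighting {X : Type*} [NormedAddCommGroup X] [NormedSpace ℝ X]
    [CompleteSpace X] [TopologicalSpace.SeparableSpace X]
    [MeasurableSpace X] [BorelSpace X]
    (μ : Measure X) (hμ : IsCenteredGaussian μ)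
    (f g : X → ℝ) (hf : Measurable f) (hg : Measurable g)
    (hfi : Integrable (fun x => Real.exp (f x)) μ)
    (hgi : Integrable (fun x => Real.exp (-g x)) μ)
    (hsymm : ∀ x, f (-x) + g (-x) = f x + g x)
    (hqc : ∀ c : ℝ, Convex ℝ {x | c ≤ f x + g x})
    (hGauss : IsCenteredGaussian
      ((∫⁻ x, ENNReal.ofReal (Real.exp (-g x)) ∂μ)⁻¹ •
        μ.withDensity fun x => ENNReal.ofReal (Real.exp (-g x))))
    (A : Set X) (hA : MeasurableSet A) (hAconv : Convex ℝ A)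
    (hAsymm : ∀ x ∈ A, -x ∈ A) :
    (∫ x in A, Real.exp (-g x) ∂μ) / (∫ x, Real.exp (-g x) ∂μ)
      ≤ (∫ x in A, Real.exp (f x) ∂μ) / (∫ x, Real.exp (f x) ∂μ) := by
  obtain ⟨hprob, -⟩ := hμ
  obtain ⟨hprobν, hmap⟩ := hGauss
  have : SecondCountableTopology X := UniformSpace.secondCountable_of_separable X
  set Z := ∫⁻ x, ENNReal.ofReal (Real.exp (-g x)) ∂μ with hZ
  set ν := Z⁻¹ • μ.withDensity fun x => ENNReal.ofReal (Real.exp (-g x)) with hν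
  have hνG : IsGaussian ν := isGaussian_of_map_eq_gaussianReal fun L ↦ by
    obtain ⟨v, hv⟩ := hmap L
    exact ⟨0, v, hv⟩
  have hmean : ∀ L : StrongDual ℝ X, ∫ x, L x ∂ν = 0 := fun L ↦ by
    obtain ⟨v, hv⟩ := hmap L
    have h1 : ∫ y, y ∂(ν.map L) = ∫ x, L x ∂ν :=
      integral_map L.continuous.aemeasurable aestronglyMeasurable_id
    rw [← h1, hv, integral_id_gaussianReal]
  have hgm : Measurable fun x ↦ ENNReal.ofReal (Real.exp (-g x)) := by fun_prop
  have hdens (S : Set X) (hS : MeasurableSet S) :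
      ∫⁻ x in S, ENNReal.ofReal (Real.exp (f x + g x)) ∂ν =
        Z⁻¹ * ∫⁻ x in S, ENNReal.ofReal (Real.exp (f x)) ∂μ := by
    rw [hν, Measure.restrict_smul, lintegral_smul_measure, smul_eq_mul, restrict_withDensity hS,
      lintegral_withDensity_eq_lintegral_mul _ hgm (by fun_prop)]
    congr 1
    refine lintegral_congr fun x ↦ ?_
    rw [Pi.mul_apply, ← ENNReal.ofReal_mul (Real.exp_pos _).le, ← Real.exp_add]
    congr 2
    ring
  have hkey := IsGaussian.measure_mul_lintegral_le ν hmean hA hAconv hAsymm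
    (h := fun x ↦ Real.exp (f x + g x)) (by fun_prop) (fun x ↦ (Real.exp_pos _).le)
    (fun t ht ↦ by simpa only [Real.log_le_iff_le_exp ht] using hqc (Real.log t))
    (fun x ↦ by rw [hsymm])
  rw [← setLIntegral_univ, hdens _ MeasurableSet.univ, hdens A hA, setLIntegral_univ, hν,
    Measure.smul_apply, smul_eq_mul, withDensity_apply _ hA,
    ← ofReal_integral_eq_lintegral_ofReal hfi (ae_of_all _ fun x ↦ (Real.exp_pos _).le),
    ← ofReal_integral_eq_lintegral_ofReal hfi.integrableOn
      (ae_of_all _ fun x ↦ (Real.exp_pos _).le),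
    ← ofReal_integral_eq_lintegral_ofReal hgi.integrableOn
      (ae_of_all _ fun x ↦ (Real.exp_pos _).le),
    hZ, ← ofReal_integral_eq_lintegral_ofReal hgi (ae_of_all _ fun x ↦ (Real.exp_pos _).le)] at hkey
  have hGpos := integral_exp_pos hgi
  have hFpos := integral_exp_pos hfi
  have hFA : 0 ≤ ∫ x in A, Real.exp (f x) ∂μ := integral_nonneg fun x ↦ (Real.exp_pos _).le
  have hGA : 0 ≤ ∫ x in A, Real.exp (-g x) ∂μ := integral_nonneg fun x ↦ (Real.exp_pos _).le
  rw [← ENNReal.ofReal_inv_of_pos hGpos, ← ENNReal.ofReal_mul (by positivity),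
    ← ENNReal.ofReal_mul (by positivity), ← ENNReal.ofReal_mul (by positivity),
    ← ENNReal.ofReal_mul (by positivity), ENNReal.ofReal_le_ofReal_iff (by positivity),
    mul_left_comm] at hkey
  have h1 := le_of_mul_le_mul_left hkey (inv_pos.2 hGpos)
  rwa [le_div_iff₀ hFpos, div_eq_inv_mul]
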